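/- arXiv:math/0603430 — 2 statements merged into one kernel-verified Lean document; each statement's English description precedes it below -/
import Mathlib

section
/- Let d ≥ 1 be an integer, R > 0, and let K : [0,∞) → ℝ be a bounded, nonnegative, measurable function supported in [0,R]. For j ≥ 1 set m_{K,j} := ∫₀^R s^{j−1} K(s) ds and assume m_{K,d} > 0; define the kernel moment ratios B_p := m_{K,d+p}/m_{K,d}. Let f₁ : ℝ^d → ℝ be a nonnegative integrable function, continuously differentiable in a neighborhood of 0, with f₁(0) > 0. Then, as p → 0⁺, the weighted mean square distance (∫_{ℝ^d} ‖ω‖² K(‖ω‖/p) f₁(ω) dω) / (∫_{ℝ^d} K(‖ω‖/p) f₁(ω) dω) equals B₂ p² + O(p³). -/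
open MeasureTheory Filter Topology Asymptotics

theorem aux_int (d : ℕ) (R : ℝ) (hR : 0 < R)
    (K : ℝ → ℝ) (hKmeas : Measurable K) (hKnonneg : ∀ s, 0 ≤ K s)
    (M : ℝ) (hM : ∀ s, K s ≤ M)
    (hKsupp : ∀ s, R < s → K s = 0) (p : ℝ) (hp : 0 < p) :
    Integrable (fun ω : EuclideanSpace ℝ (Fin d) => K (‖ω‖ / p)) := by
  have h1 : IntegrableOn (fun ω : EuclideanSpace ℝ (Fin d) => K (‖ω‖ / p))
      (Metric.closedBall 0 (R * p)) := by
    refine Measure.integrableOn_of_bounded (M := M) ?_ ?_ ?_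
    · exact (measure_closedBall_lt_top).ne
    · exact (hKmeas.comp (measurable_norm.div_const p)).aestronglyMeasurable
    · refine Eventually.of_forall fun ω => ?_
      rw [Real.norm_eq_abs, abs_of_nonneg (hKnonneg _)]
      exact hM _
  rw [integrableOn_iff_integrable_of_support_subset] at h1
  · exact h1
  · intro ω hω
    rw [mem_closedBall_zero_iff]
    by_contra hc
    push Not at hc
    exact hω (hKsupp _ ((lt_div_iff₀ hp).2 hc))

theorem aux_bdd_int (d : ℕ) (R : ℝ) (hR : 0 < R)
    (K : ℝ → ℝ) (hKmeas : Measurable K) (hKnonneg : ∀ s, 0 ≤ K s)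
    (M : ℝ) (hM : ∀ s, K s ≤ M)
    (hKsupp : ∀ s, R < s → K s = 0) (p : ℝ) (hp : 0 < p)
    (f : EuclideanSpace ℝ (Fin d) → ℝ) (hf : Integrable f) (n : ℕ) :
    Integrable (fun ω : EuclideanSpace ℝ (Fin d) => ‖ω‖ ^ n * K (‖ω‖ / p) * f ω) := by
  refine Integrable.bdd_mul (c := (R * p) ^ n * M) hf ?_ ?_
  · exact ((measurable_norm.pow_const n).mul
      (hKmeas.comp (measurable_norm.div_const p))).aestronglyMeasurable
  · refine Eventually.of_forall fun ω => ?_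
    have hM0 : 0 ≤ M := (hKnonneg 0).trans (hM 0)
    rw [Real.norm_eq_abs, abs_of_nonneg (mul_nonneg (by positivity) (hKnonneg _))]
    rcases le_or_gt ‖ω‖ (R * p) with h | h
    · exact mul_le_mul (pow_le_pow_left₀ (norm_nonneg _) h n) (hM _) (hKnonneg _) (by positivity)
    · rw [hKsupp _ ((lt_div_iff₀ hp).2 h)]
      simp only [mul_zero]
      positivity

theorem aux_moment (d : ℕ) (hd : 1 ≤ d) (R : ℝ) (hR : 0 < R)
    (K : ℝ → ℝ) (hKsupp : ∀ s, R < s → K s = 0) (j : ℕ) (p : ℝ) (hp : 0 < p) :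
    ∫ ω : EuclideanSpace ℝ (Fin d), ‖ω‖ ^ j * K (‖ω‖ / p) =
      p ^ j * (p ^ d * (d * ((volume : Measure (EuclideanSpace ℝ (Fin d))).real
        (Metric.ball 0 1) * ∫ s in (0:ℝ)..R, s ^ (d + j - 1) * K s))) := by
  haveI : Nonempty (Fin d) := ⟨⟨0, hd⟩⟩
  have e1 : ∀ ω : EuclideanSpace ℝ (Fin d), ‖ω‖ ^ j * K (‖ω‖ / p) =
      p ^ j * ((fun u : EuclideanSpace ℝ (Fin d) => ‖u‖ ^ j * K ‖u‖) (p⁻¹ • ω)) := by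
    intro ω
    have : ‖p⁻¹ • ω‖ = ‖ω‖ / p := by
      rw [norm_smul, Real.norm_eq_abs, abs_of_pos (inv_pos.2 hp)]; field_simp
    simp only [this, div_pow]
    field_simp
  simp_rw [e1]
  rw [integral_const_mul, Measure.integral_comp_inv_smul volume
    (fun u : EuclideanSpace ℝ (Fin d) => ‖u‖ ^ j * K ‖u‖)]
  rw [integral_fun_norm_addHaar volume (fun y : ℝ => y ^ j * K y)]
  rw [finrank_euclideanSpace_fin, abs_of_pos (pow_pos hp d)]
  simp only [smul_eq_mul, nsmul_eq_mul]
  congr 4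
  rw [intervalIntegral.integral_of_le hR.le]
  rw [← setIntegral_eq_of_subset_of_forall_sdiff_eq_zero (s := Set.Ioc 0 R) measurableSet_Ioi
    Set.Ioc_subset_Ioi_self]
  · refine setIntegral_congr_fun measurableSet_Ioi fun y _ => ?_
    have : d + j - 1 = (d - 1) + j := by omega
    simp only [this, pow_add]
    ring
  · intro x hx
    have : R < x := by
      by_contra hc
      exact hx.2 ⟨hx.1, not_lt.1 hc⟩
    rw [hKsupp x this]; ring

/-- Step–bandwidth relation for the generalized gradient: the kernel-weighted mean
square pair distance equals `B₂ p² + O(p³)` as the aspect ratio `p → 0⁺`. -/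
theorem stmt_3 (d : ℕ) (hd : 1 ≤ d) (R : ℝ) (hR : 0 < R)
    (K : ℝ → ℝ) (hKmeas : Measurable K) (hKnonneg : ∀ s, 0 ≤ K s)
    (hKbdd : ∃ M, ∀ s, K s ≤ M)
    (hKsupp : ∀ s, R < s → K s = 0)
    (mK : ℕ → ℝ) (hmK : ∀ j, mK j = ∫ s in (0:ℝ)..R, s ^ (j - 1) * K s)
    (hmKd : 0 < mK d)
    (B : ℕ → ℝ) (hB : ∀ p, B p = mK (d + p) / mK d)
    (f₁ : EuclideanSpace ℝ (Fin d) → ℝ) (hf₁int : Integrable f₁)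
    (hf₁nonneg : ∀ x, 0 ≤ f₁ x) (hf₁pos : 0 < f₁ 0)
    (hf₁smooth : ∃ ε > 0,
      ContDiffOn ℝ 1 f₁ (Metric.ball (0 : EuclideanSpace ℝ (Fin d)) ε)) :
    (fun p : ℝ =>
        (∫ ω : EuclideanSpace ℝ (Fin d), ‖ω‖ ^ 2 * K (‖ω‖ / p) * f₁ ω) /
          (∫ ω : EuclideanSpace ℝ (Fin d), K (‖ω‖ / p) * f₁ ω)
          - B 2 * p ^ 2)
      =O[𝓝[>] (0 : ℝ)] fun p => p ^ 3 := by
  obtain ⟨M, hM⟩ := hKbdd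
  obtain ⟨ε, hε, hf⟩ := hf₁smooth
  have hca : ContDiffAt ℝ 1 f₁ 0 := hf.contDiffAt (Metric.ball_mem_nhds _ hε)
  obtain ⟨L, t, ht, hL⟩ := hca.exists_lipschitzOnWith
  obtain ⟨δ, hδ, hδt⟩ := Metric.mem_nhds_iff.1 ht
  have hLip : ∀ ω, ‖ω‖ < δ → |f₁ ω - f₁ 0| ≤ L * ‖ω‖ := by
    intro ω hω
    have := hL.dist_le_mul ω (hδt (by simpa using hω)) 0 (hδt (by simpa using hδ))
    simpa [Real.dist_eq] using this
  have hL0 : (0:ℝ) ≤ L := L.2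
  set C : ℝ := (R ^ 2 + |B 2|) * (L * R) with hC
  have hC0 : 0 ≤ C := by positivity
  refine IsBigO.of_bound (C / (f₁ 0 / 2)) ?_
  have ev1 : ∀ᶠ p : ℝ in 𝓝[>] 0, R * p < δ := by
    have : Tendsto (fun p : ℝ => R * p) (𝓝[>] 0) (𝓝 (R * 0)) :=
      ((continuous_const.mul continuous_id).tendsto 0).mono_left nhdsWithin_le_nhds
    exact this.eventually_lt_const (by simpa using hδ)
  have ev2 : ∀ᶠ p : ℝ in 𝓝[>] 0, L * (R * p) < f₁ 0 / 2 := by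
    have : Tendsto (fun p : ℝ => L * (R * p)) (𝓝[>] 0) (𝓝 (L * (R * 0))) :=
      ((continuous_const.mul (continuous_const.mul continuous_id)).tendsto 0).mono_left
        nhdsWithin_le_nhds
    exact this.eventually_lt_const (by simpa using hf₁pos)
  filter_upwards [ev1, ev2, self_mem_nhdsWithin] with p h1 h2 hp
  have hp : 0 < p := hp
  have hw := aux_int d R hR K hKmeas hKnonneg M hM hKsupp p hp
  have i2 := aux_bdd_int d R hR K hKmeas hKnonneg M hM hKsupp p hp f₁ hf₁int 2
  have i0 : Integrable (fun ω : EuclideanSpace ℝ (Fin d) => K (‖ω‖ / p) * f₁ ω) := by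
    simpa using aux_bdd_int d R hR K hKmeas hKnonneg M hM hKsupp p hp f₁ hf₁int 0
  have hmom0 := aux_moment d hd R hR K hKsupp 0 p hp
  have hmom2 := aux_moment d hd R hR K hKsupp 2 p hp
  rw [← hmK] at hmom0 hmom2
  simp only [pow_zero, one_mul, add_zero] at hmom0
  set V := (volume : Measure (EuclideanSpace ℝ (Fin d))).real (Metric.ball 0 1) with hV
  have hVpos : 0 < V := by
    rw [hV]
    exact ENNReal.toReal_pos (Metric.measure_ball_pos _ _ one_pos).ne' measure_ball_lt_top.ne
  have hdpos : (0:ℝ) < d := by exact_mod_cast hd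
  set I := ∫ ω : EuclideanSpace ℝ (Fin d), K (‖ω‖ / p) with hI
  have hIpos : 0 < I := by rw [hmom0]; positivity
  have hmom : ∫ ω : EuclideanSpace ℝ (Fin d), ‖ω‖ ^ 2 * K (‖ω‖ / p) = B 2 * p ^ 2 * I := by
    rw [hmom2, hmom0, hB]
    field_simp
  have j2 : Integrable (fun ω : EuclideanSpace ℝ (Fin d) => ‖ω‖ ^ 2 * K (‖ω‖ / p)) := by
    have hi : Integrable ((Metric.closedBall (0 : EuclideanSpace ℝ (Fin d)) (R * p)).indicator
        (fun _ => (1:ℝ))) :=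
      (integrable_indicator_iff measurableSet_closedBall).2
        (integrableOn_const (measure_closedBall_lt_top).ne)
    refine (aux_bdd_int d R hR K hKmeas hKnonneg M hM hKsupp p hp _ hi 2).congr
      (Eventually.of_forall fun ω => ?_)
    simp only
    rcases le_or_gt ‖ω‖ (R * p) with h | h
    · rw [Set.indicator_of_mem (by simpa using h), mul_one]
    · simp [hKsupp _ ((lt_div_iff₀ hp).2 h)]
  have near : ∀ ω : EuclideanSpace ℝ (Fin d), ‖ω‖ ≤ R * p → |f₁ ω - f₁ 0| ≤ L * (R * p) := by
    intro ω hω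
    exact (hLip ω (hω.trans_lt h1)).trans (mul_le_mul_of_nonneg_left hω hL0)
  have far : ∀ ω : EuclideanSpace ℝ (Fin d), R * p < ‖ω‖ → K (‖ω‖ / p) = 0 := by
    intro ω hω
    exact hKsupp _ ((lt_div_iff₀ hp).2 hω)
  set N := ∫ ω : EuclideanSpace ℝ (Fin d), ‖ω‖ ^ 2 * K (‖ω‖ / p) * f₁ ω with hN
  set D := ∫ ω : EuclideanSpace ℝ (Fin d), K (‖ω‖ / p) * f₁ ω with hD
  have hDlow : f₁ 0 / 2 * I ≤ D := by
    rw [hI, hD, ← integral_const_mul]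
    refine integral_mono (hw.const_mul _) i0 fun ω => ?_
    simp only
    rcases le_or_gt ‖ω‖ (R * p) with h | h
    · have := (abs_le.1 (near ω h)).1
      rw [mul_comm]
      exact mul_le_mul_of_nonneg_left (by linarith) (hKnonneg _)
    · simp [far ω h]
  have hDpos : 0 < D := lt_of_lt_of_le (by positivity) hDlow
  have hkey : N - B 2 * p ^ 2 * D = ∫ ω : EuclideanSpace ℝ (Fin d),
      (‖ω‖ ^ 2 - B 2 * p ^ 2) * K (‖ω‖ / p) * (f₁ ω - f₁ 0) := by
    have e : ∀ ω : EuclideanSpace ℝ (Fin d),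
        (‖ω‖ ^ 2 - B 2 * p ^ 2) * K (‖ω‖ / p) * (f₁ ω - f₁ 0) =
        (‖ω‖ ^ 2 * K (‖ω‖ / p) * f₁ ω - B 2 * p ^ 2 * (K (‖ω‖ / p) * f₁ ω)) -
        (f₁ 0 * (‖ω‖ ^ 2 * K (‖ω‖ / p)) - f₁ 0 * (B 2 * p ^ 2) * K (‖ω‖ / p)) := by
      intro ω; ring
    simp_rw [e]
    have k1 : Integrable (fun ω : EuclideanSpace ℝ (Fin d) =>
        ‖ω‖ ^ 2 * K (‖ω‖ / p) * f₁ ω - B 2 * p ^ 2 * (K (‖ω‖ / p) * f₁ ω)) :=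
      i2.sub (i0.const_mul _)
    have k2 : Integrable (fun ω : EuclideanSpace ℝ (Fin d) =>
        f₁ 0 * (‖ω‖ ^ 2 * K (‖ω‖ / p)) - f₁ 0 * (B 2 * p ^ 2) * K (‖ω‖ / p)) :=
      (j2.const_mul _).sub (hw.const_mul _)
    rw [integral_sub k1 k2,
      integral_sub i2 (i0.const_mul _), integral_sub (j2.const_mul _) (hw.const_mul _),
      integral_const_mul, integral_const_mul, integral_const_mul, hmom]
    ring
  have hup : |N - B 2 * p ^ 2 * D| ≤ C * p ^ 3 * I := by
    rw [hkey, hI, ← integral_const_mul, ← Real.norm_eq_abs]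
    refine norm_integral_le_of_norm_le (hw.const_mul _) (Eventually.of_forall fun ω => ?_)
    rcases le_or_gt ‖ω‖ (R * p) with h | h
    · rw [Real.norm_eq_abs, abs_mul, abs_mul, abs_of_nonneg (hKnonneg _)]
      have a1 : |‖ω‖ ^ 2 - B 2 * p ^ 2| ≤ (R ^ 2 + |B 2|) * p ^ 2 := by
        calc |‖ω‖ ^ 2 - B 2 * p ^ 2| ≤ |‖ω‖ ^ 2| + |B 2 * p ^ 2| := abs_sub _ _
          _ = ‖ω‖ ^ 2 + |B 2| * p ^ 2 := by
            rw [abs_mul, abs_of_nonneg (sq_nonneg p), abs_of_nonneg (sq_nonneg ‖ω‖)]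
          _ ≤ (R * p) ^ 2 + |B 2| * p ^ 2 := by gcongr
          _ = _ := by ring
      calc _ ≤ ((R ^ 2 + |B 2|) * p ^ 2) * K (‖ω‖ / p) * (L * (R * p)) := by
            have := hKnonneg (‖ω‖ / p)
            have := near ω h
            gcongr
        _ = _ := by rw [hC]; ring
    · simp [far ω h]
  have hq : N / D - B 2 * p ^ 2 = (N - B 2 * p ^ 2 * D) / D := by
    field_simp
  rw [hq, Real.norm_eq_abs, Real.norm_eq_abs, abs_div, abs_of_pos hDpos,
    abs_of_pos (pow_pos hp 3), div_le_iff₀ hDpos]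
  refine hup.trans ?_
  calc C * p ^ 3 * I = C / (f₁ 0 / 2) * p ^ 3 * (f₁ 0 / 2 * I) := by field_simp
    _ ≤ _ := by gcongr
end

section
/- Let d ≥ 1 be an integer, R > 0, and let K : [0,∞) → ℝ be a bounded, nonnegative, measurable function supported in [0,R]. For j ≥ 1 set m_{K,j} := ∫₀^R s^{j−1} K(s) ds and assume m_{K,d} > 0; define the kernel moment ratios B_p := m_{K,d+p}/m_{K,d}. Let F : [0,∞) → ℝ be continuous with F(t) = τ₁ t + τ₂ t² + τ₃ t³ + o(t³) as t → 0⁺ for real constants τ₁, τ₂, τ₃, and define the kernel average I_F(h) := (∫₀^R u^{d−1} K(u) F(hu) du)/m_{K,d}. Then, as h → 0⁺, I_F(h) − F(B₂^{1/2} h) = τ₁ (B₁ − B₂^{1/2}) h + τ₃ (B₃ − B₂^{3/2}) h³ + o(h³). -/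
open MeasureTheory Filter Topology Asymptotics

/-- Mean of the sample gradient constraint, continuous (non-differentiable) case,
bias at the consistency-principle step `a₁ = B₂^{1/2} h`: if
`F(t) = τ₁ t + τ₂ t² + τ₃ t³ + o(t³)` as `t → 0⁺`, then
`I_F(h) − F(B₂^{1/2} h) = τ₁ (B₁ − B₂^{1/2}) h + τ₃ (B₃ − B₂^{3/2}) h³ + o(h³)`. -/
theorem stmt_9 (d : ℕ) (hd : 1 ≤ d) (R : ℝ) (hR : 0 < R)
    (K : ℝ → ℝ) (hKmeas : Measurable K) (hKnonneg : ∀ s, 0 ≤ K s)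
    (hKbdd : ∃ M, ∀ s, K s ≤ M)
    (hKsupp : ∀ s, R < s → K s = 0)
    (mK : ℕ → ℝ) (hmK : ∀ j, mK j = ∫ s in (0:ℝ)..R, s ^ (j - 1) * K s)
    (hmKd : 0 < mK d)
    (B : ℕ → ℝ) (hB : ∀ p, B p = mK (d + p) / mK d)
    (F : ℝ → ℝ) (hFcont : ContinuousOn F (Set.Ici 0))
    (τ₁ τ₂ τ₃ : ℝ)
    (hF : (fun t => F t - (τ₁ * t + τ₂ * t ^ 2 + τ₃ * t ^ 3))
      =o[𝓝[>] (0:ℝ)] fun t => t ^ 3)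
    (IF : ℝ → ℝ)
    (hIF : ∀ h, IF h = (∫ u in (0:ℝ)..R, u ^ (d - 1) * K u * F (h * u)) / mK d) :
    (fun h => IF h - F (Real.sqrt (B 2) * h)
        - (τ₁ * (B 1 - Real.sqrt (B 2)) * h
          + τ₃ * (B 3 - Real.sqrt (B 2) ^ 3) * h ^ 3))
      =o[𝓝[>] (0:ℝ)] fun h => h ^ 3 := by
  obtain ⟨M, hM⟩ := hKbdd
  have hw : ∀ n : ℕ, IntervalIntegrable (fun u => u ^ n * K u) volume 0 R := by
    intro n
    have hK : IntervalIntegrable K volume 0 R := by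
      refine (intervalIntegrable_const (c := M)).mono_fun hKmeas.aestronglyMeasurable ?_
      refine Filter.Eventually.of_forall fun s => ?_
      simp only [Real.norm_eq_abs]
      rw [abs_of_nonneg (hKnonneg s)]
      exact (hM s).trans (le_abs_self M)
    exact hK.continuousOn_mul (by fun_prop)
  have hmK' : ∀ p, mK (d + p) = ∫ s in (0:ℝ)..R, s ^ (d - 1) * K s * s ^ p := by
    intro p
    rw [hmK, show d + p - 1 = (d - 1) + p by omega]
    congr 1
    ext s
    ring
  have hw' : ∀ p : ℕ, IntervalIntegrable (fun u => u ^ (d - 1) * K u * u ^ p) volume 0 R := by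
    intro p
    exact (hw (d - 1)).mul_continuousOn (by fun_prop)
  set P : ℝ → ℝ := fun t => τ₁ * t + τ₂ * t ^ 2 + τ₃ * t ^ 3 with hP
  set g : ℝ → ℝ := fun t => F t - P t with hg
  have hgcont : ContinuousOn g (Set.Ici 0) := hFcont.sub (by fun_prop)
  have hg0 : g 0 = 0 := by
    have h1 : Tendsto g (𝓝[>] 0) (𝓝 (g 0)) :=
      ((hgcont 0 Set.self_mem_Ici).mono Set.Ioi_subset_Ici_self)
    have h2 : Tendsto (fun t : ℝ => t ^ 3) (𝓝[>] 0) (𝓝 0) := by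
      have : Continuous (fun t : ℝ => t ^ 3) := by fun_prop
      simpa using (this.tendsto 0).mono_left nhdsWithin_le_nhds
    exact tendsto_nhds_unique h1 (hF.trans_tendsto h2)
  have hbd : ∀ ε > 0, ∃ δ > 0, ∀ t, 0 ≤ t → t < δ → |g t| ≤ ε * t ^ 3 := by
    intro ε hε
    have h1 := hF.def hε
    obtain ⟨δ, hδ, h⟩ := mem_nhdsGT_iff_exists_Ioo_subset.1 h1
    refine ⟨δ, hδ, fun t ht htd => ?_⟩
    rcases ht.eq_or_lt with rfl | ht
    · simp [hg0]
    · have h3 := h ⟨ht, htd⟩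
      simp only [Set.mem_ofPred_eq, Real.norm_eq_abs] at h3
      rwa [abs_of_pos (pow_pos ht 3)] at h3
  have hB2 : 0 ≤ B 2 := by
    rw [hB, hmK']
    refine div_nonneg (intervalIntegral.integral_nonneg hR.le fun u hu => ?_) hmKd.le
    have := hKnonneg u
    have := hu.1
    positivity
  set c := Real.sqrt (B 2) with hc
  have hc0 : 0 ≤ c := Real.sqrt_nonneg _
  have hc2 : c ^ 2 = B 2 := Real.sq_sqrt hB2
  have hgint : ∀ h, 0 < h →
      IntervalIntegrable (fun u => u ^ (d - 1) * K u * g (h * u)) volume 0 R := by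
    intro h hh
    refine (hw (d - 1)).mul_continuousOn ?_
    refine hgcont.comp (by fun_prop) ?_
    intro u hu
    rw [Set.uIcc_of_le hR.le] at hu
    exact mul_nonneg hh.le hu.1
  have key : ∀ h, 0 < h → IF h - F (c * h) - (τ₁ * (B 1 - c) * h + τ₃ * (B 3 - c ^ 3) * h ^ 3)
      = (∫ u in (0:ℝ)..R, u ^ (d - 1) * K u * g (h * u)) / mK d - g (c * h) := by
    intro h hh
    have e : (∫ u in (0:ℝ)..R, u ^ (d - 1) * K u * F (h * u))
        = (∫ u in (0:ℝ)..R, u ^ (d - 1) * K u * g (h * u))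
          + (τ₁ * h * mK (d + 1) + τ₂ * h ^ 2 * mK (d + 2) + τ₃ * h ^ 3 * mK (d + 3)) := by
      rw [hmK', hmK', hmK', ← intervalIntegral.integral_const_mul,
        ← intervalIntegral.integral_const_mul, ← intervalIntegral.integral_const_mul,
        ← intervalIntegral.integral_add ((hw' 1).const_mul _) ((hw' 2).const_mul _),
        ← intervalIntegral.integral_add (((hw' 1).const_mul _).add ((hw' 2).const_mul _))
          ((hw' 3).const_mul _),
        ← intervalIntegral.integral_add (hgint h hh)
          ((((hw' 1).const_mul _).add ((hw' 2).const_mul _)).add ((hw' 3).const_mul _))]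
      congr 1
      ext u
      simp only [hg, hP]
      ring
    have hF' : F (c * h) = g (c * h) + (τ₁ * (c * h) + τ₂ * (B 2 * h ^ 2) + τ₃ * (c * h) ^ 3) := by
      rw [← hc2]
      simp only [hg, hP]
      ring
    rw [hIF, e, hF', hB 1, hB 2, hB 3]
    field_simp
    ring
  refine IsLittleO.of_bound fun η hη => ?_
  have hD : 0 < R ^ 3 + c ^ 3 := by positivity
  obtain ⟨δ, hδ, hgd⟩ := hbd (η / (R ^ 3 + c ^ 3)) (by positivity)
  set ε := η / (R ^ 3 + c ^ 3) with hε
  have hε0 : 0 < ε := by positivity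
  have hRc : 0 < R + c := by positivity
  filter_upwards [Ioo_mem_nhdsGT (show (0:ℝ) < δ / (R + c) by positivity)] with h hh
  have h0 : 0 < h := hh.1
  have h1 : h * (R + c) < δ := (lt_div_iff₀ hRc).1 hh.2
  have hch : |g (c * h)| ≤ ε * (c * h) ^ 3 :=
    hgd _ (by positivity) (by nlinarith [mul_pos h0 hR])
  have hint : |∫ u in (0:ℝ)..R, u ^ (d - 1) * K u * g (h * u)| ≤ ε * (h * R) ^ 3 * mK d := by
    rw [hmK d, ← intervalIntegral.integral_const_mul, ← Real.norm_eq_abs]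
    refine intervalIntegral.norm_integral_le_of_norm_le hR.le ?_ ((hw (d - 1)).const_mul _)
    refine Filter.Eventually.of_forall fun u hu => ?_
    have hu0 := hu.1
    have hk := hKnonneg u
    have hwn : 0 ≤ u ^ (d - 1) * K u := by positivity
    have hle : h * u ≤ h * R := mul_le_mul_of_nonneg_left hu.2 h0.le
    have hgu : |g (h * u)| ≤ ε * (h * u) ^ 3 :=
      hgd _ (by positivity) (by nlinarith [mul_nonneg h0.le hc0])
    have hgu2 : |g (h * u)| ≤ ε * (h * R) ^ 3 :=
      hgu.trans (by gcongr)
    rw [Real.norm_eq_abs, abs_mul, abs_of_nonneg hwn, mul_comm]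
    exact mul_le_mul_of_nonneg_right hgu2 hwn
  rw [key h h0, Real.norm_eq_abs, Real.norm_eq_abs, abs_of_pos (pow_pos h0 3)]
  have hdiv : |(∫ u in (0:ℝ)..R, u ^ (d - 1) * K u * g (h * u)) / mK d| ≤ ε * (h * R) ^ 3 := by
    rw [abs_div, abs_of_pos hmKd]
    exact (div_le_iff₀ hmKd).2 hint
  have hη' : η = ε * (R ^ 3 + c ^ 3) := by
    rw [hε]
    field_simp
  calc _ ≤ _ := abs_sub _ _
    _ ≤ ε * (h * R) ^ 3 + ε * (c * h) ^ 3 := add_le_add hdiv hch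
    _ = η * h ^ 3 := by rw [hη']; ring
end
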